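/- Weak duality: for every matrix A ∈ 𝕋±^{d×n}, at least one of the sets nnker(A) and sep(A) is empty; equivalently, for every y ∈ 𝕋±^d and every x ∈ 𝕋≥^n with x ≠ (𝟘,…,𝟘), it cannot both hold that every component of A⊙x is balanced or 𝟘 and that every component of yᵀ⊙A is a strictly positive signed element. -/

import Mathlib

/-!  Signed tropical numbers 𝕋±, the symmetrized tropical semiring 𝕊,
     and signed tropical convexity (Loho–Végh). -/

inductive SSign : Type where
  | pos : SSign
  | neg : SSign
  | bal : SSign
deriving DecidableEq

/-- The symmetrized tropical semiring 𝕊: the tropical zero 𝟘 = -∞ together with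
elements `elem s r` where `s` is a sign (⊕, ⊖ or •) and `r` a real number. -/
inductive STrop : Type where
  | zero : STrop
  | elem : SSign → ℝ → STrop

namespace STrop

/-- membership in the signed tropical numbers 𝕋± (i.e. not balanced-nonzero). -/
def isSigned : STrop → Prop
  | elem SSign.bal _ => False
  | _ => True

/-- membership in 𝕋≥, the nonnegative tropical numbers. -/
def nneg : STrop → Prop
  | zero => True
  | elem SSign.pos _ => True
  | _ => False

/-- membership in 𝕋≤, the nonpositive tropical numbers. -/
def npos : STrop → Prop
  | zero => True
  | elem SSign.neg _ => True
  | _ => False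

/-- strictly positive signed element (sign ⊕, not 𝟘). -/
def isPos : STrop → Prop
  | elem SSign.pos _ => True
  | _ => False

/-- balanced or 𝟘 (membership in 𝕋•). -/
def balZero : STrop → Prop
  | zero => True
  | elem SSign.bal _ => True
  | _ => False

/-- the negation map ⊖. -/
def neg : STrop → STrop
  | zero => zero
  | elem SSign.pos r => elem SSign.neg r
  | elem SSign.neg r => elem SSign.pos r
  | elem SSign.bal r => elem SSign.bal r

/-- tropical addition ⊕ on 𝕊. -/
noncomputable def add : STrop → STrop → STrop
  | zero, y => y
  | x, zero => x
  | elem s r, elem t u =>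
    if r < u then elem t u
    else if u < r then elem s r
    else if s = t then elem s r
    else elem SSign.bal r

def signMul : SSign → SSign → SSign
  | SSign.pos, t => t
  | SSign.neg, SSign.pos => SSign.neg
  | SSign.neg, SSign.neg => SSign.pos
  | SSign.neg, SSign.bal => SSign.bal
  | SSign.bal, _ => SSign.bal

/-- tropical multiplication ⊙ on 𝕊. -/
def mul : STrop → STrop → STrop
  | zero, _ => zero
  | _, zero => zero
  | elem s r, elem t u => elem (signMul s t) (r + u)

/-- a ⊖ b := a ⊕ (⊖b). -/
noncomputable def sub (x y : STrop) : STrop := add x (neg y)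

/-- the tropical one, the signed element ⊕0. -/
def one : STrop := elem SSign.pos 0

/-- the absolute value |·| : 𝕊 → 𝕋≥. -/
def absS : STrop → STrop
  | zero => zero
  | elem _ r => elem SSign.pos r

/-- strict order: x > y iff x ⊖ y is a strictly positive signed element. -/
def sgt (x y : STrop) : Prop := isPos (sub x y)

/-- balance relation: x ⋈ y iff x ⊖ y is balanced or 𝟘. -/
def bal (x y : STrop) : Prop := balZero (sub x y)

/-- the relation ⊵ : x ⊵ y iff x > y or x ⋈ y. -/
def teq (x y : STrop) : Prop := sgt x y ∨ bal x y

/-- the total order ≤ on the signed tropical numbers 𝕋±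
(arbitrarily `False` whenever a balanced element is involved). -/
def sle : STrop → STrop → Prop
  | zero, zero => True
  | zero, elem SSign.pos _ => True
  | elem SSign.neg _, zero => True
  | elem SSign.neg _, elem SSign.pos _ => True
  | elem SSign.pos r, elem SSign.pos u => r ≤ u
  | elem SSign.neg r, elem SSign.neg u => u ≤ r
  | _, _ => False

/-- U(a): the set of signed numbers incomparable with a; the singleton {a}
for signed a, and the order interval [⊖|a|, |a|] for balanced a. -/
def U : STrop → Set STrop
  | elem SSign.bal r => {x | isSigned x ∧ sle (elem SSign.neg r) x ∧ sle x (elem SSign.pos r)}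
  | a => {a}

/-- tropical sum of finitely many elements of 𝕊. -/
noncomputable def sumFin : ∀ {n : ℕ}, (Fin n → STrop) → STrop
  | 0, _ => zero
  | _ + 1, f => add (f 0) (sumFin fun i => f i.succ)

/-- matrix–vector product A ⊙ x over 𝕊. -/
noncomputable def mv {d n : ℕ} (A : Fin d → Fin n → STrop) (x : Fin n → STrop) : Fin d → STrop :=
  fun i => sumFin fun j => mul (A i j) (x j)

/-- vectors in 𝕋±^d. -/
def isSignedVec {d : ℕ} (v : Fin d → STrop) : Prop := ∀ i, isSigned (v i)

/-- the signed tropical convex hull of the columns of a matrix A: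
tconv(A) = {z ∈ 𝕋±^d : z ⋈ A⊙x for some x ∈ 𝕋≥^n with ⊕_j x_j = 0}. -/
def tconv {d n : ℕ} (A : Fin d → Fin n → STrop) : Set (Fin d → STrop) :=
  {z | isSignedVec z ∧ ∃ x : Fin n → STrop,
    (∀ j, nneg (x j)) ∧ sumFin x = one ∧ ∀ i, bal (z i) (mv A x i)}

/-- the signed tropical convex hull of an arbitrary set: the union of the hulls
of all finite collections of points of M. -/
def tconvSet {d : ℕ} (M : Set (Fin d → STrop)) : Set (Fin d → STrop) :=
  ⋃ (n : ℕ) (A : Fin d → Fin n → STrop) (_ : ∀ j, (fun i => A i j) ∈ M), tconv A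

/-- a set M ⊆ 𝕋±^d is tropically convex iff M = tconv(M). -/
def TropConvex {d : ℕ} (M : Set (Fin d → STrop)) : Prop := M = tconvSet M

/-- evaluation a ⊙ (0, x₁, …, x_d)ᵀ of an affine functional. -/
noncomputable def affEval {d : ℕ} (a : Fin (d + 1) → STrop) (x : Fin d → STrop) : STrop :=
  sumFin fun j => mul (a j) ((Fin.cons one x : Fin (d + 1) → STrop) j)

/-- the open signed tropical halfspace H⁺(a) = {x ∈ 𝕋±^d : a⊙(0,x)ᵀ > 𝟘}. -/
def Hopen {d : ℕ} (a : Fin (d + 1) → STrop) : Set (Fin d → STrop) :=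
  {x | isSignedVec x ∧ sgt (affEval a x) zero}

/-- the closed signed tropical halfspace H̄⁺(a) = {x ∈ 𝕋±^d : a⊙(0,x)ᵀ ⊵ 𝟘}. -/
def Hclosed {d : ℕ} (a : Fin (d + 1) → STrop) : Set (Fin d → STrop) :=
  {x | isSignedVec x ∧ teq (affEval a x) zero}

/-- the non-negative kernel nnker(A). -/
def nnker {d n : ℕ} (A : Fin d → Fin n → STrop) : Set (Fin n → STrop) :=
  {x | (∀ j, nneg (x j)) ∧ x ≠ (fun _ => zero) ∧ ∀ i, balZero (mv A x i)}

/-- the open tropical cone sep(A) = {y ∈ 𝕋±^d : yᵀ⊙A > 𝟘 componentwise}. -/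
def sep {d : ℕ} {J : Type} (A : Fin d → J → STrop) : Set (Fin d → STrop) :=
  {y | isSignedVec y ∧ ∀ j, isPos (sumFin fun i => mul (y i) (A i j))}

end STrop

namespace STrop

theorem eq_zero_of_sumFin_eq_zero {n : ℕ} {f : Fin n → STrop} (h : sumFin f = zero)
    (k : Fin n) : f k = zero := by
  induction n with
  | zero => exact k.elim0
  | succ n ih =>
    have key : f 0 = zero ∧ sumFin (fun i => f i.succ) = zero := by
      rw [sumFin] at h
      generalize f 0 = x, sumFin (fun i => f i.succ) = y at h
      rcases x with _ | ⟨s, r⟩ <;> rcases y with _ | ⟨t, u⟩ <;> simp only [add] at h <;>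
        grind
    exact Fin.cases key.1 (fun i => ih key.2 i) k

/-- The real number `r` is the largest absolute value among the nonzero entries of `f`. -/
def IsMaxAbs {n : ℕ} (f : Fin n → STrop) (r : ℝ) : Prop :=
  (∀ k t u, f k = elem t u → u ≤ r) ∧ ∃ k t, f k = elem t r

/-- The sign `s` is the combined sign of the entries of `f` with absolute value `r`: it is the
common sign of these entries if there is one, and balanced otherwise. -/
def IsSignAt {n : ℕ} (f : Fin n → STrop) (r : ℝ) (s : SSign) : Prop :=
  (s ≠ SSign.bal → ∀ k t, f k = elem t r → t = s) ∧
    (s = SSign.bal → (∃ k, f k = elem SSign.bal r) ∨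
      (∃ k, f k = elem SSign.pos r) ∧ ∃ k, f k = elem SSign.neg r)

theorem isMaxAbs_and_isSignAt_of_sumFin_eq_elem {n : ℕ} {f : Fin n → STrop} {s : SSign} {r : ℝ}
    (h : sumFin f = elem s r) : IsMaxAbs f r ∧ IsSignAt f r s := by
  induction n generalizing s r with
  | zero => simp [sumFin] at h
  | succ n ih =>
    rw [sumFin] at h
    unfold IsMaxAbs IsSignAt at *
    simp only [Fin.forall_fin_succ, Fin.exists_fin_succ]
    rcases hy : sumFin (fun i => f i.succ) with _ | ⟨t, u⟩
    · have hz := eq_zero_of_sumFin_eq_zero hy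
      rw [hy] at h
      rcases hx : f 0 with _ | ⟨a, v⟩ <;> rw [hx] at h <;> simp only [add] at h
      · cases h
      · grind
    · have ht := ih hy
      clear ih
      rw [hy] at h
      rcases hx : f 0 with _ | ⟨a, v⟩ <;> rw [hx] at h <;> simp only [add] at h
      · grind
      · obtain ⟨⟨hle, hex⟩, hs, hb⟩ := ht
        rcases lt_trichotomy v u with hvu | hvu | hvu
        · grind
        · subst hvu
          cases a <;> cases t <;> grind
        · grind

/-- The absolute value of an element of `𝕊`, with the tropical zero sent to `⊥`. -/
def absVal : STrop → WithBot ℝ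
  | zero => ⊥
  | elem _ r => r

theorem eq_elem_of_mul_eq_elem {x y : STrop} {s : SSign} {r : ℝ} (h : mul x y = elem s r) :
    ∃ a u b v, x = elem a u ∧ y = elem b v ∧ signMul a b = s ∧ u + v = r := by
  rcases x with _ | ⟨a, u⟩ <;> rcases y with _ | ⟨b, v⟩ <;> simp only [mul] at h
  all_goals grind

theorem sign_eq_pos_of_isPos_sumFin {n : ℕ} {f : Fin n → STrop} (h : isPos (sumFin f))
    {k : Fin n} {s : SSign} {r : ℝ} (hk : f k = elem s r)
    (hmax : ∀ i t u, f i = elem t u → u ≤ r) : s = SSign.pos := by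
  rcases hf : sumFin f with _ | ⟨_ | _ | _, u⟩ <;> rw [hf] at h <;> simp only [isPos] at h
  obtain ⟨⟨hle, i, t, hi⟩, hs, -⟩ := isMaxAbs_and_isSignAt_of_sumFin_eq_elem hf
  obtain rfl : r = u := le_antisymm (hle _ _ _ hk) (hmax _ _ _ hi)
  exact hs (by simp) _ _ hk

theorem exists_ne_sign_of_balZero_sumFin {n : ℕ} {f : Fin n → STrop} (h : balZero (sumFin f))
    {k : Fin n} {s : SSign} {r : ℝ} (hk : f k = elem s r) (hs : s ≠ SSign.bal)
    (hmax : ∀ i t u, f i = elem t u → u ≤ r) : ∃ i t, f i = elem t r ∧ t ≠ s := by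
  rcases hf : sumFin f with _ | ⟨_ | _ | _, u⟩ <;> rw [hf] at h <;> simp only [balZero] at h
  · simp [eq_zero_of_sumFin_eq_zero hf k] at hk
  · obtain ⟨⟨hle, i, t, hi⟩, -, hb⟩ := isMaxAbs_and_isSignAt_of_sumFin_eq_elem hf
    obtain rfl : r = u := le_antisymm (hle _ _ _ hk) (hmax _ _ _ hi)
    rcases hb rfl with ⟨i, hi⟩ | ⟨⟨i, hi⟩, l, hl⟩
    · exact ⟨i, _, hi, hs.symm⟩
    · by_cases h : s = SSign.pos
      · exact ⟨l, _, hl, by simp [h]⟩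
      · exact ⟨i, _, hi, Ne.symm h⟩

theorem exists_eq_elem_of_isPos_sumFin {n : ℕ} {f : Fin n → STrop} (h : isPos (sumFin f)) :
    ∃ k s r, f k = elem s r := by
  rcases hf : sumFin f with _ | ⟨s, r⟩
  · simp [hf, isPos] at h
  · obtain ⟨⟨-, k, t, hk⟩, -⟩ := isMaxAbs_and_isSignAt_of_sumFin_eq_elem hf
    exact ⟨k, t, r, hk⟩

theorem exists_eq_pos_of_nneg {x : STrop} (hx : nneg x) (h0 : x ≠ zero) :
    ∃ w, x = elem SSign.pos w := by
  rcases x with _ | ⟨_ | _ | _, w⟩ <;> simp_all [nneg]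

theorem signMul_pos (s : SSign) : signMul s SSign.pos = s := by
  cases s <;> rfl

theorem eq_of_signMul_eq_pos {a b c : SSign} (hb : signMul a b = SSign.pos)
    (hc : signMul a c = SSign.pos) : b = c := by
  cases a <;> cases b <;> cases c <;> simp_all [signMul]

theorem not_balZero_mv_and_isPos {d n : ℕ} {A : Fin d → Fin n → STrop}
    (hA : ∀ i j, isSigned (A i j)) {y : Fin d → STrop} {x : Fin n → STrop}
    (hx : ∀ j, nneg (x j)) (hx0 : x ≠ fun _ => zero) :
    ¬((∀ i, balZero (mv A x i)) ∧ ∀ j, isPos (sumFin fun i => mul (y i) (A i j))) := by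
  rintro ⟨hbal, hpos⟩
  obtain ⟨j₀, hj₀⟩ := Function.ne_iff.mp hx0
  obtain ⟨w₀, hw₀⟩ := exists_eq_pos_of_nneg (hx j₀) hj₀
  obtain ⟨i₀, s₀, r₀, h₀⟩ := exists_eq_elem_of_isPos_sumFin (hpos j₀)
  have : Nonempty (Fin d × Fin n) := ⟨(i₀, j₀)⟩
  obtain ⟨⟨i, j⟩, hmax⟩ := Finite.exists_max
    fun p : Fin d × Fin n => absVal (mul (mul (y p.1) (A p.1 p.2)) (x p.2))
  rcases hM : mul (mul (y i) (A i j)) (x j) with _ | ⟨s, M⟩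
  · have h := hmax (i₀, j₀)
    simp only [hM, h₀, hw₀] at h
    simp [mul, absVal] at h
  have hle : ∀ k l a u b v c w, y k = elem a u → A k l = elem b v → x l = elem c w →
      u + v + w ≤ M := by
    intro k l a u b v c w hy hb hc
    have h := hmax (k, l)
    simp only [hM, hy, hb, hc] at h
    simpa only [mul, absVal, WithBot.coe_le_coe] using h
  have hcol : ∀ l a u b v c w, y i = elem a u → A i l = elem b v → x l = elem c w →
      u + v + w = M → signMul a b = SSign.pos := by
    intro l a u b v c w hy hb hc hsum
    refine sign_eq_pos_of_isPos_sumFin (hpos l) (k := i) (r := u + v)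
      (by simp only [hy, hb, mul]) ?_
    intro k t z hk
    obtain ⟨a', u', b', v', ha', hb', -, rfl⟩ := eq_elem_of_mul_eq_elem hk
    linarith [hle _ _ _ _ _ _ _ _ ha' hb' hc]
  obtain ⟨_, _, c, w, hya, hxw, -, hsum⟩ := eq_elem_of_mul_eq_elem hM
  obtain ⟨a, u, b, v, hy, hb, -, rfl⟩ := eq_elem_of_mul_eq_elem hya
  obtain rfl : c = SSign.pos := by
    have h := hx j
    cases c <;> simp_all [nneg]
  have hbs : b ≠ SSign.bal := by
    rintro rfl
    have h := hA i j
    simp [hb, isSigned] at h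
  obtain ⟨l, t, hl, ht⟩ := exists_ne_sign_of_balZero_sumFin (hbal i) (k := j) (s := b)
    (r := v + w) (by simp only [hb, hxw, mul, signMul_pos]) hbs (by
      intro k t z hk
      obtain ⟨b', v', c', w', hb', hc', -, rfl⟩ := eq_elem_of_mul_eq_elem hk
      linarith [hle _ _ _ _ _ _ _ _ hy hb' hc'])
  obtain ⟨b', v', c', w', hb', hc', rfl, hsum'⟩ := eq_elem_of_mul_eq_elem hl
  obtain rfl : c' = SSign.pos := by
    have h := hx l
    cases c' <;> simp_all [nneg]
  rw [signMul_pos] at ht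
  exact ht (eq_of_signMul_eq_pos (hcol l _ _ _ _ _ _ hy hb' hc' (by linarith))
    (hcol j _ _ _ _ _ _ hy hb hxw hsum))

end STrop

/-- weak duality between the non-negative kernel and the open
tropical cone. -/
theorem weak_duality (d n : ℕ) (A : Fin d → Fin n → STrop)
    (hA : ∀ i j, STrop.isSigned (A i j)) :
    (STrop.nnker A = ∅ ∨ STrop.sep A = ∅) ∧
    (∀ (y : Fin d → STrop) (x : Fin n → STrop), STrop.isSignedVec y →
      (∀ j, STrop.nneg (x j)) → x ≠ (fun _ => STrop.zero) →
      ¬ ((∀ i, STrop.balZero (STrop.mv A x i)) ∧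
         (∀ j, STrop.isPos (STrop.sumFin fun i => STrop.mul (y i) (A i j))))) := by
  refine ⟨?_, fun y x _ hx hx0 => STrop.not_balZero_mv_and_isPos hA hx hx0⟩
  by_contra! h
  obtain ⟨⟨x, hx, hx0, hbal⟩, y, -, hpos⟩ := h
  exact STrop.not_balZero_mv_and_isPos hA hx hx0 ⟨hbal, hpos⟩
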